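/- (Newton's identity, antisymmetric form) For a q-super Manin matrix M, with A(t) = \sum_{k\ge 0} (-t)^k str_{1,...,k}(\mathcal{A}_k^q M_1 \cdots M_k) and T(t) = \sum_{k\ge 0} t^k str(M^{[k+1]}), one has \partial_t A(t) = - A(t) T(t). -/

import Mathlib

open scoped BigOperators Classical
open Finset

namespace QSM

/-- Parity of a basis index of `ℂ^{m|n}`: `0` (even) for indices `< m`, `1` (odd) otherwise. -/
def pa (m : ℕ) {N : ℕ} (i : Fin N) : ℕ := if (i : ℕ) < m then 0 else 1

/-- The sign `ε(i - j)`: `1` if `i > j`, `0` if `i = j`, `-1` if `i < j`. -/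
def eps {N : ℕ} (i j : Fin N) : ℤ :=
  if (j : ℕ) < (i : ℕ) then 1 else if (i : ℕ) < (j : ℕ) then -1 else 0

variable {B : Type*} [Ring B] [Algebra ℂ B]

/-- Map a complex matrix into a matrix over the `ℂ`-algebra `B`. -/
noncomputable def cmap {I : Type*} (X : Matrix I I ℂ) : Matrix I I B :=
  X.map (algebraMap ℂ B)

/-- The super tensor product `E_{ij} ⊗ E_{kl}` of matrix units, as an operator on the
graded tensor square of `ℂ^{m|n}` (super sign conventions). -/
noncomputable def stu (m : ℕ) {N : ℕ} (i j k l : Fin N) :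
    Matrix (Fin N × Fin N) (Fin N × Fin N) ℂ :=
  Matrix.of fun p r =>
    ((-1 : ℂ) ^ ((pa m k + pa m l) * pa m r.1)) *
      (if p.1 = i ∧ r.1 = j then 1 else 0) * (if p.2 = k ∧ r.2 = l then 1 else 0)

/-- The operator `P^q = ∑_{i,j} q^{ε(i-j)} (-1)^{\bar j} E_{ij} ⊗ E_{ji}` on
`(ℂ^{m|n})^{⊗2}`. -/
noncomputable def Pq (q : ℂ) (m : ℕ) {N : ℕ} : Matrix (Fin N × Fin N) (Fin N × Fin N) ℂ :=
  ∑ i : Fin N, ∑ j : Fin N, (q ^ eps i j * (-1 : ℂ) ^ pa m j) • stu m i j j i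

/-- `M₁ = ∑ (-1)^{\bar i\bar j+\bar j} M_{ij} ⊗ E_{ij} ⊗ 1` on the tensor square. -/
noncomputable def Mone (m : ℕ) {N : ℕ} (M : Matrix (Fin N) (Fin N) B) :
    Matrix (Fin N × Fin N) (Fin N × Fin N) B :=
  Matrix.of fun p r =>
    if p.2 = r.2 then
      ((-1 : ℂ) ^ (pa m p.1 * pa m r.1 + pa m r.1)) • M p.1 r.1
    else 0

/-- `M₂ = ∑ (-1)^{\bar i\bar j+\bar j} M_{ij} ⊗ 1 ⊗ E_{ij}` on the tensor square
(with the super sign of `1 ⊗ E_{ij}`). -/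
noncomputable def Mtwo (m : ℕ) {N : ℕ} (M : Matrix (Fin N) (Fin N) B) :
    Matrix (Fin N × Fin N) (Fin N × Fin N) B :=
  Matrix.of fun p r =>
    if p.1 = r.1 then
      ((-1 : ℂ) ^ (pa m p.2 * pa m r.2 + pa m r.2 + (pa m p.2 + pa m r.2) * pa m r.1)) •
        M p.2 r.2
    else 0

/-- The `q`-super Manin matrix condition in matrix form:
`(1 - P^q) M₁ M₂ (1 + P^q) = 0`. -/
def IsManin (q : ℂ) (m : ℕ) {N : ℕ} (M : Matrix (Fin N) (Fin N) B) : Prop :=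
  (1 - cmap (Pq q m)) * Mone m M * Mtwo m M * (1 + cmap (Pq q m)) = 0

/-- The entrywise relations of the right quantum superalgebra `𝓜_{m|n}`. -/
def ManinRel (q : ℂ) (m : ℕ) {N : ℕ} (M : Matrix (Fin N) (Fin N) B) : Prop :=
  (∀ i j, pa m i = 1 → pa m j = 0 → M i j * M i j = 0) ∧
  (∀ i k l, pa m i = 1 →
    M i k * M i l = (q ^ eps l k * (-1 : ℂ) ^ ((pa m k + 1) * (pa m l + 1))) • (M i l * M i k)) ∧
  (∀ i j k, pa m k = 0 →
    M i k * M j k = (q ^ eps i j * (-1 : ℂ) ^ (pa m i * pa m j)) • (M j k * M i k)) ∧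
  (∀ i j k l,
    M i j * M k l -
        (q ^ (eps i k + eps l j) * (-1 : ℂ) ^ ((pa m i + pa m j) * (pa m k + pa m l))) •
          (M k l * M i j)
      = (q ^ eps i k * (-1 : ℂ) ^ (pa m i * pa m k + pa m j * pa m k + pa m i * pa m j)) •
            (M k j * M i l)
        - (q ^ eps l j * (-1 : ℂ) ^ (pa m j * pa m k + pa m j * pa m l + pa m k * pa m l)) •
            (M i l * M k j))

/-- The operator `P^q_σ` on `(ℂ^{m|n})^{⊗k}` (defined via reduced decompositions of `σ`;
equivalently, by the explicit inversion formula used here). -/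
noncomputable def Pperm (q : ℂ) (m : ℕ) {N k : ℕ} (σ : Equiv.Perm (Fin k)) :
    Matrix (Fin k → Fin N) (Fin k → Fin N) ℂ :=
  Matrix.of fun f g =>
    if f = g ∘ ⇑σ⁻¹ then
      ∏ p ∈ Finset.univ.filter (fun p : Fin k × Fin k => p.1 < p.2 ∧ σ p.2 < σ p.1),
        (q ^ eps (g p.1) (g p.2) * (-1 : ℂ) ^ (pa m (g p.1) * pa m (g p.2)))
    else 0

/-- The `q`-antisymmetrizer over the tensor positions in `S`. -/
noncomputable def AqS (q : ℂ) (m : ℕ) {N k : ℕ} (S : Finset (Fin k)) :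
    Matrix (Fin k → Fin N) (Fin k → Fin N) ℂ :=
  (S.card.factorial : ℂ)⁻¹ •
    ∑ σ ∈ Finset.univ.filter (fun σ : Equiv.Perm (Fin k) => ∀ t ∉ S, σ t = t),
      (((Equiv.Perm.sign σ : ℤ) : ℂ)) • Pperm q m (N := N) σ

/-- The `q`-symmetrizer over the tensor positions in `S`. -/
noncomputable def HqS (q : ℂ) (m : ℕ) {N k : ℕ} (S : Finset (Fin k)) :
    Matrix (Fin k → Fin N) (Fin k → Fin N) ℂ :=
  (S.card.factorial : ℂ)⁻¹ •
    ∑ σ ∈ Finset.univ.filter (fun σ : Equiv.Perm (Fin k) => ∀ t ∉ S, σ t = t),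
      Pperm q m (N := N) σ

/-- `M_a`: the copy of `M` in the `a`-th slot of `B ⊗ End(ℂ^{m|n})^{⊗k}`, with the super
sign factors `(-1)^{\bar i\bar j+\bar j}` and the super signs of `1⊗⋯⊗E_{ij}⊗⋯⊗1`. -/
noncomputable def Mslot (m : ℕ) {N k : ℕ} (M : Matrix (Fin N) (Fin N) B) (a : Fin k) :
    Matrix (Fin k → Fin N) (Fin k → Fin N) B :=
  Matrix.of fun f g =>
    if ∀ b, b ≠ a → f b = g b then
      ((-1 : ℂ) ^ (pa m (f a) * pa m (g a) + pa m (g a)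
          + (pa m (f a) + pa m (g a)) *
              ∑ b ∈ Finset.univ.filter (fun b => b < a), pa m (g b))) •
        M (f a) (g a)
    else 0

/-- The product `M₁ M₂ ⋯ M_k`. -/
noncomputable def MProd (m : ℕ) {N : ℕ} (M : Matrix (Fin N) (Fin N) B) (k : ℕ) :
    Matrix (Fin k → Fin N) (Fin k → Fin N) B :=
  (List.ofFn fun a : Fin k => Mslot m M a).prod

/-- The `q`-super Manin condition in the form `𝒜₂^q M₁ M₂ ℋ₂^q = 0`. -/
def IsManin2 (q : ℂ) (m : ℕ) {N : ℕ} (M : Matrix (Fin N) (Fin N) B) : Prop :=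
  cmap (AqS q m (Finset.univ : Finset (Fin 2))) * Mslot m M (0 : Fin 2) *
      Mslot m M (1 : Fin 2) * cmap (HqS q m (Finset.univ : Finset (Fin 2))) = 0

/-- The supertrace `str_{1,…,k}` over all `k` tensor slots. -/
noncomputable def strAll (m : ℕ) {N k : ℕ}
    (X : Matrix (Fin k → Fin N) (Fin k → Fin N) B) : B :=
  ∑ f : Fin k → Fin N, ((-1 : ℂ) ^ (∑ t, pa m (f t))) • X f f

/-- The supertrace of an `N × N` matrix. -/
noncomputable def strM (m : ℕ) {N : ℕ} (X : Matrix (Fin N) (Fin N) B) : B :=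
  ∑ i, ((-1 : ℂ) ^ pa m i) • X i i

/-- The star product `B * C = str₁ (P^q_{12} B₁ C₂)`. -/
noncomputable def starMul (q : ℂ) (m : ℕ) {N : ℕ} (X Y : Matrix (Fin N) (Fin N) B) :
    Matrix (Fin N) (Fin N) B :=
  Matrix.of fun i j =>
    ((-1 : ℂ) ^ (pa m i * pa m j + pa m j)) •
      ∑ a : Fin N, ((-1 : ℂ) ^ (pa m a * (1 + pa m i + pa m j))) •
        ((cmap (Pperm q m (Equiv.swap (0 : Fin 2) 1)) * Mslot m X (0 : Fin 2) *
            Mslot m Y (1 : Fin 2) :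
          Matrix (Fin 2 → Fin N) (Fin 2 → Fin N) B) ![a, i] ![a, j])

/-- The powers `M^{[k]}` of `M` with respect to the star product. -/
noncomputable def Mpow (q : ℂ) (m : ℕ) {N : ℕ} (M : Matrix (Fin N) (Fin N) B) :
    ℕ → Matrix (Fin N) (Fin N) B
  | 0 => 1
  | 1 => M
  | (j + 2) => starMul q m (Mpow q m M (j + 1)) M

/-- Coefficient of `t^k` in `A(t) = ∑ (-t)^k str_{1,…,k}(𝒜_k^q M₁⋯M_k)`. -/
noncomputable def coefA (q : ℂ) (m : ℕ) {N : ℕ} (M : Matrix (Fin N) (Fin N) B) (k : ℕ) : B :=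
  ((-1 : ℂ) ^ k) •
    strAll m (cmap (AqS q m (Finset.univ : Finset (Fin k))) * MProd m M k)

/-- Coefficient of `t^k` in `S(t) = ∑ t^k str_{1,…,k}(ℋ_k^q M₁⋯M_k)`. -/
noncomputable def coefS (q : ℂ) (m : ℕ) {N : ℕ} (M : Matrix (Fin N) (Fin N) B) (k : ℕ) : B :=
  strAll m (cmap (HqS q m (Finset.univ : Finset (Fin k))) * MProd m M k)

/-- Coefficient of `t^k` in `T(t) = ∑ t^k str(M^{[k+1]})`. -/
noncomputable def coefT (q : ℂ) (m : ℕ) {N : ℕ} (M : Matrix (Fin N) (Fin N) B) (k : ℕ) : B :=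
  strM m (Mpow q m M (k + 1))

/-- Coefficients `M^{i_1…i_k}_{j_1…j_k}` of `𝒜_k^q M₁⋯M_k` in the basis
`E_{i_1j_1} ⊗ ⋯ ⊗ E_{i_kj_k}` (super sign conventions). -/
noncomputable def MIJ (q : ℂ) (m : ℕ) {N k : ℕ} (M : Matrix (Fin N) (Fin N) B)
    (f g : Fin k → Fin N) : B :=
  ((-1 : ℂ) ^ (∑ a : Fin k, (pa m (f a) + pa m (g a)) *
      ∑ b ∈ Finset.univ.filter (fun b => b < a), pa m (g b))) •
    ((cmap (AqS q m (Finset.univ : Finset (Fin k))) * MProd m M k :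
      Matrix (Fin k → Fin N) (Fin k → Fin N) B) f g)

/-- Number of inversions (the length `l(σ)`) of a permutation. -/
def invCount {r : ℕ} (σ : Equiv.Perm (Fin r)) : ℕ :=
  (Finset.univ.filter fun p : Fin r × Fin r => p.1 < p.2 ∧ σ p.2 < σ p.1).card

/-- The quantum determinant `det_q(A) = ∑_σ (-q)^{-l(σ)} A_{σ(1),1} ⋯ A_{σ(r),r}`. -/
noncomputable def detq (q : ℂ) {r : ℕ} (A : Matrix (Fin r) (Fin r) B) : B :=
  ∑ σ : Equiv.Perm (Fin r),
    ((-q) ^ (-(invCount σ : ℤ))) • (List.ofFn fun i : Fin r => A (σ i) i).prod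

/-- The quantum Berezinian of a type `(r|s)` matrix `A` with (two-sided) inverse `Ainv`. -/
noncomputable def Ber (q : ℂ) (r s : ℕ) (A Ainv : Matrix (Fin (r + s)) (Fin (r + s)) B) : B :=
  (∑ σ : Equiv.Perm (Fin r), ((-q) ^ (-(invCount σ : ℤ))) •
      (List.ofFn fun i : Fin r => A (Fin.castAdd s (σ i)) (Fin.castAdd s i)).prod) *
  (∑ ρ : Equiv.Perm (Fin s), ((-q) ^ (-(invCount ρ : ℤ))) •
      (List.ofFn fun j : Fin s => Ainv (Fin.natAdd r j) (Fin.natAdd r (ρ j))).prod)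

/-- The `Π ∘ st` transform of a type `(r'|s')` matrix: a type `(s'|r')` matrix. -/
noncomputable def PiSt (r' s' : ℕ) (A : Matrix (Fin (r' + s')) (Fin (r' + s')) B) :
    Matrix (Fin (s' + r')) (Fin (s' + r')) B :=
  Matrix.of fun i j =>
    ((-1 : ℂ) ^ (pa s' i * (pa s' i + pa s' j))) •
      A (Fin.rev (Fin.cast (Nat.add_comm s' r') j)) (Fin.rev (Fin.cast (Nat.add_comm s' r') i))

/-- Left corner embedding `Fin a → Fin b`. -/
def embL (a b : ℕ) (h : a ≤ b) : Fin a → Fin b :=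
  fun i => ⟨(i : ℕ), lt_of_lt_of_le i.isLt h⟩

/-- Embedding of `Fin a` into `Fin b` shifted by `c`. -/
def embR (c a b : ℕ) (h : c + a ≤ b) : Fin a → Fin b :=
  fun i => ⟨c + (i : ℕ), by have := i.isLt; omega⟩

/-- `P^q ⊗ 1` on the triple tensor space. -/
noncomputable def P12 (q : ℂ) (m : ℕ) {N : ℕ} :
    Matrix (Fin N × Fin N × Fin N) (Fin N × Fin N × Fin N) ℂ :=
  Matrix.of fun p r =>
    Pq q m (p.1, p.2.1) (r.1, r.2.1) * (if p.2.2 = r.2.2 then 1 else 0)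

/-- `1 ⊗ P^q` on the triple tensor space (no extra super sign: `P^q` is even). -/
noncomputable def P23 (q : ℂ) (m : ℕ) {N : ℕ} :
    Matrix (Fin N × Fin N × Fin N) (Fin N × Fin N × Fin N) ℂ :=
  Matrix.of fun p r =>
    (if p.1 = r.1 then 1 else 0) * Pq q m (p.2.1, p.2.2) (r.2.1, r.2.2)

/-- The scalar by which `P^q` transposes two adjacent basis vectors. -/
noncomputable def swapCoeff (q : ℂ) (m : ℕ) {N : ℕ} (x y : Fin N) : ℂ :=
  q ^ eps x y * (-1 : ℂ) ^ (pa m x * pa m y)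

/-- The nonzero entry of `P^q_σ` in the column `g`. -/
noncomputable def permWeight (q : ℂ) (m : ℕ) {N k : ℕ} (σ : Equiv.Perm (Fin k))
    (g : Fin k → Fin N) : ℂ :=
  ∏ i, ∏ j, if i < j ∧ σ j < σ i then swapCoeff q m (g i) (g j) else 1

lemma swapCoeff_mul_swapCoeff {q : ℂ} (hq : q ≠ 0) (m : ℕ) {N : ℕ} (x y : Fin N) :
    swapCoeff q m x y * swapCoeff q m y x = 1 := by
  have h1 : eps x y = - eps y x := by unfold eps; split_ifs <;> omega
  have h2 : ((-1 : ℂ) ^ (pa m y * pa m x)) * ((-1 : ℂ) ^ (pa m y * pa m x)) = 1 := by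
    rw [← mul_pow]; simp
  have h3 : q ^ (-eps y x) * q ^ eps y x = 1 := by
    rw [← zpow_add₀ hq]; simp
  unfold swapCoeff
  rw [h1, mul_comm (pa m x) (pa m y)]
  linear_combination (q ^ (-eps y x) * q ^ eps y x) * h2 + h3

lemma Pperm_apply (q : ℂ) (m : ℕ) {N k : ℕ} (σ : Equiv.Perm (Fin k)) (f g : Fin k → Fin N) :
    Pperm q m σ f g = if g = f ∘ ⇑σ then permWeight q m σ g else 0 := by
  have h : (f = g ∘ ⇑σ⁻¹) ↔ g = f ∘ ⇑σ := by
    constructor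
    · rintro rfl; ext; simp
    · rintro rfl; ext; simp
  simp only [Pperm, Matrix.of_apply, h, permWeight, swapCoeff]
  rw [Finset.prod_filter, ← Finset.univ_product_univ, Finset.prod_product]

lemma permWeight_mul {q : ℂ} (hq : q ≠ 0) (m : ℕ) {N k : ℕ} (σ τ : Equiv.Perm (Fin k))
    (g : Fin k → Fin N) :
    permWeight q m (σ * τ) (g ∘ τ) = permWeight q m σ g * permWeight q m τ (g ∘ τ) := by
  have h0 : ∀ x y : Fin N, swapCoeff q m x y ≠ 0 := fun x y =>
    left_ne_zero_of_mul_eq_one (swapCoeff_mul_swapCoeff hq m x y)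
  have hσ : permWeight q m σ g = ∏ p : Fin k × Fin k,
      if τ p.1 < τ p.2 ∧ σ (τ p.2) < σ (τ p.1) then
        swapCoeff q m (g (τ p.1)) (g (τ p.2)) else 1 := by
    rw [permWeight, ← Finset.univ_product_univ, Finset.prod_product, ← Equiv.prod_comp τ]
    exact Finset.prod_congr rfl fun i _ => (Equiv.prod_comp τ _).symm
  have hτ : ∀ ρ : Equiv.Perm (Fin k), permWeight q m ρ (g ∘ τ) = ∏ p : Fin k × Fin k,
      if p.1 < p.2 ∧ ρ p.2 < ρ p.1 then
        swapCoeff q m (g (τ p.1)) (g (τ p.2)) else 1 := by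
    intro ρ
    rw [permWeight, ← Finset.univ_product_univ, Finset.prod_product]
    rfl
  rw [hσ, hτ, hτ, ← Finset.prod_mul_distrib, eq_comm, ← div_eq_one_iff_eq,
    ← Finset.prod_div_distrib]
  · refine Finset.prod_involution (fun p _ => p.swap) ?_ ?_ (by simp) (by simp)
    · rintro ⟨a, b⟩ -
      have hab := swapCoeff_mul_swapCoeff hq m (g (τ a)) (g (τ b))
      have hx := h0 (g (τ a)) (g (τ b))
      have hy := h0 (g (τ b)) (g (τ a))
      have e1 : τ a = τ b ↔ a = b := τ.injective.eq_iff
      have e2 : σ (τ a) = σ (τ b) ↔ a = b := by rw [σ.injective.eq_iff, e1]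
      simp only [Prod.swap, Equiv.Perm.mul_apply]
      rcases lt_trichotomy a b with h | h | h
      · have n1 : τ a ≠ τ b := by rw [Ne, e1]; exact h.ne
        have n2 : σ (τ a) ≠ σ (τ b) := by rw [Ne, e2]; exact h.ne
        rcases lt_or_gt_of_ne n1 with h1 | h1 <;> rcases lt_or_gt_of_ne n2 with h2 | h2 <;>
          simp [h, h1, h2, h.not_gt, h1.not_gt, h2.not_gt] <;> try simp [hab, hx]
      · subst h; simp
      · have n1 : τ a ≠ τ b := by rw [Ne, e1]; exact h.ne'
        have n2 : σ (τ a) ≠ σ (τ b) := by rw [Ne, e2]; exact h.ne'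
        rcases lt_or_gt_of_ne n1 with h1 | h1 <;> rcases lt_or_gt_of_ne n2 with h2 | h2 <;>
          simp [h, h1, h2, h.not_gt, h1.not_gt, h2.not_gt] <;> try simp [hab, hy]
    · rintro ⟨a, b⟩ - hne hab
      have : a = b := by simpa using (congrArg Prod.snd hab)
      subst this
      simp at hne
  · rw [Finset.prod_ne_zero_iff]
    intro p _
    split_ifs
    exacts [h0 _ _, one_ne_zero]

lemma Pperm_mul {q : ℂ} (hq : q ≠ 0) (m : ℕ) {N k : ℕ} (σ τ : Equiv.Perm (Fin k)) :
    Pperm q m (N := N) σ * Pperm q m τ = Pperm q m (σ * τ) := by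
  ext f g
  rw [Matrix.mul_apply, Finset.sum_eq_single (f ∘ σ)]
  · simp only [Pperm_apply, if_true]
    by_cases h : g = (f ∘ σ) ∘ τ
    · subst h
      have := permWeight_mul hq m σ τ (f ∘ σ)
      simpa [Function.comp_assoc] using this.symm
    · rw [if_neg h, if_neg (by simpa [Function.comp_assoc] using h), mul_zero]
  · intro h _ hh
    rw [Pperm_apply, if_neg hh, zero_mul]
  · simp

lemma permWeight_one (q : ℂ) (m : ℕ) {N k : ℕ} (g : Fin k → Fin N) :
    permWeight q m 1 g = 1 := by
  refine Finset.prod_eq_one fun i _ => Finset.prod_eq_one fun j _ => if_neg ?_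
  simp only [Equiv.Perm.one_apply]
  exact fun h => lt_asymm h.1 h.2

lemma Pperm_one (q : ℂ) (m : ℕ) {N k : ℕ} :
    Pperm q m (N := N) (1 : Equiv.Perm (Fin k)) = 1 := by
  ext f g
  simp [Pperm_apply, permWeight_one, Matrix.one_apply, eq_comm]

lemma cmap_mul {I : Type*} [Fintype I] (X Y : Matrix I I ℂ) :
    (cmap (X * Y) : Matrix I I B) = cmap X * cmap Y := by
  ext i j
  simp [cmap, Matrix.mul_apply]

lemma cmap_one {I : Type*} [DecidableEq I] : (cmap (1 : Matrix I I ℂ) : Matrix I I B) = 1 := by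
  ext i j
  by_cases h : i = j <;> simp [cmap, Matrix.one_apply, h]

lemma cmap_add {I : Type*} (X Y : Matrix I I ℂ) :
    (cmap (X + Y) : Matrix I I B) = cmap X + cmap Y := by
  ext i j
  simp [cmap]

lemma cmap_sum {I ι : Type*} (s : Finset ι) (X : ι → Matrix I I ℂ) :
    (cmap (∑ a ∈ s, X a) : Matrix I I B) = ∑ a ∈ s, cmap (X a) := by
  ext i j
  simp [cmap, Matrix.sum_apply]

lemma cmap_smul {I : Type*} (c : ℂ) (X : Matrix I I ℂ) :
    (cmap (c • X) : Matrix I I B) = c • cmap X := by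
  ext i j
  simp [cmap, Algebra.smul_def]

lemma cmap_Pperm_mul_apply (q : ℂ) (m : ℕ) {N k : ℕ} (σ : Equiv.Perm (Fin k))
    (X : Matrix (Fin k → Fin N) (Fin k → Fin N) B) (f g : Fin k → Fin N) :
    (cmap (Pperm q m σ) * X : Matrix (Fin k → Fin N) (Fin k → Fin N) B) f g =
      permWeight q m σ (f ∘ σ) • X (f ∘ σ) g := by
  rw [Matrix.mul_apply, Finset.sum_eq_single (f ∘ σ)]
  · simp [cmap, Pperm_apply, Algebra.smul_def]
  · intro h _ hh
    simp [cmap, Pperm_apply, hh]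
  · simp

lemma mul_cmap_Pperm_apply (q : ℂ) (m : ℕ) {N k : ℕ} (σ : Equiv.Perm (Fin k))
    (X : Matrix (Fin k → Fin N) (Fin k → Fin N) B) (f g : Fin k → Fin N) :
    (X * cmap (Pperm q m σ) : Matrix (Fin k → Fin N) (Fin k → Fin N) B) f (g ∘ σ) =
      permWeight q m σ (g ∘ σ) • X f g := by
  rw [Matrix.mul_apply, Finset.sum_eq_single g]
  · simp [cmap, Pperm_apply, Algebra.smul_def, Algebra.commutes]
  · intro h _ hh
    have : ¬ (g ∘ σ = h ∘ σ) := fun e => hh (σ.surjective.injective_comp_right e).symm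
    simp [cmap, Pperm_apply, this]
  · simp

lemma strAll_Pperm_mul_comm (q : ℂ) (m : ℕ) {N k : ℕ} (σ : Equiv.Perm (Fin k))
    (X : Matrix (Fin k → Fin N) (Fin k → Fin N) B) :
    strAll m (cmap (Pperm q m σ) * X) = strAll m (X * cmap (Pperm q m σ)) := by
  unfold strAll
  rw [← Equiv.sum_comp (Equiv.arrowCongr σ.symm (Equiv.refl (Fin N)))
    (fun f => ((-1 : ℂ) ^ (∑ t, pa m (f t))) •
      (X * cmap (Pperm q m σ) : Matrix (Fin k → Fin N) (Fin k → Fin N) B) f f)]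
  refine Finset.sum_congr rfl fun f _ => ?_
  have e : (Equiv.arrowCongr σ.symm (Equiv.refl (Fin N))) f = f ∘ σ := by ext; simp
  rw [e, cmap_Pperm_mul_apply, mul_cmap_Pperm_apply]
  simp only [Function.comp_apply]
  rw [Equiv.sum_comp σ (fun t => pa m (f t))]

lemma strAll_smul (m : ℕ) {N k : ℕ} (c : ℂ) (X : Matrix (Fin k → Fin N) (Fin k → Fin N) B) :
    strAll m (c • X) = c • strAll m X := by
  simp [strAll, Finset.smul_sum, smul_comm c]

lemma strAll_sum (m : ℕ) {N k : ℕ} {ι : Type*} (s : Finset ι)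
    (X : ι → Matrix (Fin k → Fin N) (Fin k → Fin N) B) :
    strAll m (∑ a ∈ s, X a) = ∑ a ∈ s, strAll m (X a) := by
  simp only [strAll, Matrix.sum_apply, Finset.smul_sum]
  exact Finset.sum_comm

/-- The sign of the entry of `M_a` in row `f` and column `g`. -/
noncomputable def slotSign (m : ℕ) {N k : ℕ} (f g : Fin k → Fin N) (a : Fin k) : ℂ :=
  (-1 : ℂ) ^ (pa m (f a) * pa m (g a) + pa m (g a) + (pa m (f a) + pa m (g a)) *
    ∑ b ∈ Finset.univ.filter (fun b => b < a), pa m (g b))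

lemma Mslot_apply (m : ℕ) {N k : ℕ} (M : Matrix (Fin N) (Fin N) B) (a : Fin k)
    (f g : Fin k → Fin N) :
    Mslot m M a f g = if ∀ b, b ≠ a → f b = g b then slotSign m f g a • M (f a) (g a) else 0 :=
  rfl

lemma prod_take_Mslot_apply (m : ℕ) {N k : ℕ} (M : Matrix (Fin N) (Fin N) B)
    (f g : Fin k → Fin N) (r : ℕ) (hr : r ≤ k) :
    ((List.ofFn fun a : Fin k => Mslot m M a).take r).prod f g =
      if ∀ b : Fin k, r ≤ b → f b = g b then
        ((List.ofFn fun a => slotSign m f g a • M (f a) (g a)).take r).prod else 0 := by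
  induction r generalizing g with
  | zero => simp [Matrix.one_apply, funext_iff]
  | succ r ih =>
    have hrk : r < k := hr
    have hget : (List.ofFn fun a : Fin k => Mslot m M a)[r]'(by simpa using hrk) =
        Mslot m M ⟨r, hrk⟩ := List.getElem_ofFn _
    rw [List.prod_take_succ _ _ (by simpa using hrk), List.prod_take_succ _ _ (by simpa using hrk),
      Matrix.mul_apply, Finset.sum_eq_single (Function.update g ⟨r, hrk⟩ (f ⟨r, hrk⟩))]
    · rw [ih _ hrk.le]
      have hc : (∀ b : Fin k, r ≤ b → f b = Function.update g ⟨r, hrk⟩ (f ⟨r, hrk⟩) b) ↔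
          ∀ b : Fin k, r + 1 ≤ b → f b = g b := by
        refine forall_congr' fun b => ?_
        by_cases hb : b = ⟨r, hrk⟩
        · subst hb; simp
        · have : (b : ℕ) ≠ r := fun e => hb (Fin.ext e)
          rw [Function.update_of_ne hb]
          constructor <;> intro h hh <;> exact h (by omega)
      by_cases hfg : ∀ b : Fin k, r + 1 ≤ b → f b = g b
      · rw [if_pos hfg, if_pos (hc.2 hfg)]
        congr 1
        · congr 1
          refine List.ext_getElem (by simp) fun i h1 h2 => ?_
          have hir : i < r := by simp at h1; omega
          have hne : (⟨i, by omega⟩ : Fin k) ≠ ⟨r, hrk⟩ := fun e => by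
            have := congrArg Fin.val e; simp at this; omega
          simp only [List.getElem_take, List.getElem_ofFn, slotSign]
          rw [Function.update_of_ne hne]
          congr 4
          refine Finset.sum_congr rfl fun b hb => ?_
          rw [Function.update_of_ne]
          rintro rfl
          simp at hb; omega
        · rw [hget, Mslot_apply, if_pos]
          · simp [slotSign]
          · intro b hb
            rw [Function.update_of_ne hb]
      · rw [if_neg hfg, if_neg (fun h => hfg (hc.1 h)), zero_mul]
    · intro h _ hne
      rw [ih _ hrk.le]
      rw [hget, Mslot_apply]
      split_ifs with h1 h2
      · refine absurd (funext fun b => ?_) hne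
        by_cases hb : b = ⟨r, hrk⟩
        · subst hb; rw [Function.update_self]; exact (h1 _ le_rfl).symm
        · rw [Function.update_of_ne hb]; exact h2 b hb
      all_goals simp
    · simp

lemma MProd_apply (m : ℕ) {N k : ℕ} (M : Matrix (Fin N) (Fin N) B) (f g : Fin k → Fin N) :
    MProd m M k f g = (List.ofFn fun a => slotSign m f g a • M (f a) (g a)).prod := by
  have h := prod_take_Mslot_apply m M f g k le_rfl
  rw [List.take_of_length_le (by simp), List.take_of_length_le (by simp), if_pos] at h
  · exact h
  · intro b hb; exact absurd b.2 (by omega)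

lemma prod_ofFn_smul {k : ℕ} (c : Fin k → ℂ) (x : Fin k → B) :
    (List.ofFn fun a => c a • x a).prod = (∏ a, c a) • (List.ofFn x).prod := by
  induction k with
  | zero => simp
  | succ k ih => simp [List.ofFn_succ, ih, Fin.prod_univ_succ, smul_smul, mul_comm]

lemma slotSign_append_left (m : ℕ) {N a b : ℕ} (u u' : Fin a → Fin N) (v v' : Fin b → Fin N)
    (i : Fin a) :
    slotSign m (Fin.append u v) (Fin.append u' v') (Fin.castAdd b i) = slotSign m u u' i := by
  have h : ∀ j : Fin b, ¬ Fin.natAdd a j < Fin.castAdd b i := fun j h => by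
    have := Fin.lt_def.1 h
    simp at this; omega
  have h' : ∀ i j : Fin a, Fin.castAdd b i < Fin.castAdd b j ↔ i < j := fun _ _ => Iff.rfl
  simp [slotSign, Finset.sum_filter, Fin.sum_univ_add, h, h']

lemma slotSign_append_right (m : ℕ) {N a b : ℕ} (u u' : Fin a → Fin N) (v v' : Fin b → Fin N)
    (i : Fin b) :
    slotSign m (Fin.append u v) (Fin.append u' v') (Fin.natAdd a i) =
      (-1) ^ ((pa m (v i) + pa m (v' i)) * ∑ j, pa m (u' j)) * slotSign m v v' i := by
  have h : ∀ j : Fin a, Fin.castAdd b j < Fin.natAdd a i := fun j => by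
    rw [Fin.lt_def]; simp; omega
  simp only [slotSign, Finset.sum_filter, Fin.sum_univ_add, h, Fin.append_left, Fin.append_right,
    if_true, Fin.natAdd_lt_natAdd_iff]
  ring

lemma MProd_append (m : ℕ) {N a b : ℕ} (M : Matrix (Fin N) (Fin N) B)
    (u u' : Fin a → Fin N) (v v' : Fin b → Fin N) :
    MProd m M (a + b) (Fin.append u v) (Fin.append u' v') =
      ((-1 : ℂ) ^ ((∑ i, pa m (v i) + ∑ i, pa m (v' i)) * ∑ j, pa m (u' j))) •
        (MProd m M a u u' * MProd m M b v v') := by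
  simp only [MProd_apply]
  rw [List.ofFn_add, List.prod_append]
  change (List.ofFn fun i : Fin a => slotSign m (Fin.append u v) (Fin.append u' v')
    (Fin.castAdd b i) • M (Fin.append u v (Fin.castAdd b i))
      (Fin.append u' v' (Fin.castAdd b i))).prod * _ = _
  simp only [slotSign_append_left, slotSign_append_right, Fin.append_left, Fin.append_right,
    mul_smul]
  rw [prod_ofFn_smul (fun i => (-1 : ℂ) ^ ((pa m (v i) + pa m (v' i)) * ∑ j, pa m (u' j))),
    Finset.prod_pow_eq_pow_sum, ← Finset.sum_mul, Finset.sum_add_distrib, mul_smul_comm]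

/-- The block permutation of `Fin (a + b)` acting by `σ` on the first `a` and by `τ` on the last
`b` elements. -/
def blockPerm {a b : ℕ} (σ : Equiv.Perm (Fin a)) (τ : Equiv.Perm (Fin b)) :
    Equiv.Perm (Fin (a + b)) :=
  finSumFinEquiv.permCongr (Equiv.sumCongr σ τ)

@[simp] lemma blockPerm_castAdd {a b : ℕ} (σ : Equiv.Perm (Fin a)) (τ : Equiv.Perm (Fin b))
    (i : Fin a) : blockPerm σ τ (Fin.castAdd b i) = Fin.castAdd b (σ i) := by
  simp [blockPerm, Equiv.permCongr_apply]

@[simp] lemma blockPerm_natAdd {a b : ℕ} (σ : Equiv.Perm (Fin a)) (τ : Equiv.Perm (Fin b))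
    (i : Fin b) : blockPerm σ τ (Fin.natAdd a i) = Fin.natAdd a (τ i) := by
  simp [blockPerm, Equiv.permCongr_apply]

lemma append_comp_blockPerm {α : Type*} {a b : ℕ} (u : Fin a → α) (v : Fin b → α)
    (σ : Equiv.Perm (Fin a)) (τ : Equiv.Perm (Fin b)) :
    Fin.append u v ∘ blockPerm σ τ = Fin.append (u ∘ σ) (v ∘ τ) := by
  ext i
  refine Fin.addCases (fun i => ?_) (fun i => ?_) i <;> simp

lemma permWeight_blockPerm (q : ℂ) (m : ℕ) {N a b : ℕ} (u : Fin a → Fin N) (v : Fin b → Fin N)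
    (σ : Equiv.Perm (Fin a)) (τ : Equiv.Perm (Fin b)) :
    permWeight q m (blockPerm σ τ) (Fin.append u v) = permWeight q m σ u * permWeight q m τ v := by
  have h : ∀ (i : Fin a) (j : Fin b), Fin.castAdd b i < Fin.natAdd a j := fun i j => by
    rw [Fin.lt_def]; simp; omega
  have h' : ∀ i j : Fin a, Fin.castAdd b i < Fin.castAdd b j ↔ i < j := fun _ _ => Iff.rfl
  simp [permWeight, Fin.prod_univ_add, h, h', (h _ _).not_gt]
lemma one_sub_mul_one_add_apply (q : ℂ) (m : ℕ) {N k : ℕ} (σ : Equiv.Perm (Fin k))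
    (X : Matrix (Fin k → Fin N) (Fin k → Fin N) B) (f g : Fin k → Fin N) :
    ((1 - cmap (Pperm q m σ)) * X * (1 + cmap (Pperm q m σ)) :
        Matrix (Fin k → Fin N) (Fin k → Fin N) B) f (g ∘ σ) =
      X f (g ∘ σ) + permWeight q m σ (g ∘ σ) • X f g -
        permWeight q m σ (f ∘ σ) •
          (X (f ∘ σ) (g ∘ σ) + permWeight q m σ (g ∘ σ) • X (f ∘ σ) g) := by
  rw [mul_add, mul_one, sub_mul, one_mul, sub_mul, Matrix.add_apply, Matrix.sub_apply,
    Matrix.sub_apply, mul_assoc, cmap_Pperm_mul_apply, cmap_Pperm_mul_apply,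
    mul_cmap_Pperm_apply, mul_cmap_Pperm_apply, smul_add]
  abel

lemma IsManin2.one_sub_mul_one_add {q : ℂ} {m N : ℕ} {M : Matrix (Fin N) (Fin N) B}
    (hM : IsManin2 q m M) :
    (1 - cmap (Pperm q m (Equiv.swap (0 : Fin 2) 1))) * MProd m M 2 *
      (1 + cmap (Pperm q m (Equiv.swap (0 : Fin 2) 1))) = 0 := by
  have hne : (1 : Equiv.Perm (Fin 2)) ≠ Equiv.swap 0 1 := by decide
  have hu : ∀ F : Equiv.Perm (Fin 2) → Matrix (Fin 2 → Fin N) (Fin 2 → Fin N) ℂ,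
      ∑ σ, F σ = F 1 + F (Equiv.swap 0 1) := fun F => by
    rw [show (Finset.univ : Finset (Equiv.Perm (Fin 2))) = {1, Equiv.swap 0 1} by decide,
      Finset.sum_pair hne]
  have hA : AqS q m (N := N) (Finset.univ : Finset (Fin 2)) =
      (2 : ℂ)⁻¹ • (1 - Pperm q m (Equiv.swap (0 : Fin 2) 1)) := by
    simp [AqS, hu, Pperm_one, sub_eq_add_neg]
  have hH : HqS q m (N := N) (Finset.univ : Finset (Fin 2)) =
      (2 : ℂ)⁻¹ • (1 + Pperm q m (Equiv.swap (0 : Fin 2) 1)) := by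
    simp [HqS, hu, Pperm_one]
  have hs : ∀ X : Matrix (Fin 2 → Fin N) (Fin 2 → Fin N) ℂ,
      (cmap (1 - X) : Matrix _ _ B) = 1 - cmap X := fun X => by
    rw [eq_sub_iff_add_eq, ← cmap_add, sub_add_cancel, cmap_one]
  rw [IsManin2, hA, hH, cmap_smul, cmap_smul, hs, cmap_add, cmap_one] at hM
  simp only [smul_mul_assoc, mul_smul_comm, smul_smul] at hM
  have := (smul_eq_zero_iff_right (by norm_num : ((2 : ℂ)⁻¹ * 2⁻¹) ≠ 0)).1 hM
  simpa [MProd, List.ofFn_succ, mul_assoc] using this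

lemma exists_append {α : Type*} {a b : ℕ} (f : Fin (a + b) → α) :
    ∃ u v, f = Fin.append (m := a) (n := b) u v :=
  ⟨_, _, (Fin.append_castAdd_natAdd (f := f)).symm⟩

lemma sum_pa_append (m : ℕ) {N a b : ℕ} (u : Fin a → Fin N) (v : Fin b → Fin N) :
    ∑ i, pa m (Fin.append u v i) = ∑ i, pa m (u i) + ∑ i, pa m (v i) := by
  simp [Fin.sum_univ_add]

lemma one_sub_blockPerm_mul_MProd {q : ℂ} {m N : ℕ} {M : Matrix (Fin N) (Fin N) B}
    (hM : IsManin2 q m M) (a b : ℕ) :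
    (1 - cmap (Pperm q m (blockPerm (blockPerm (1 : Equiv.Perm (Fin a))
          (Equiv.swap (0 : Fin 2) 1)) (1 : Equiv.Perm (Fin b))))) * MProd m M (a + 2 + b) *
      (1 + cmap (Pperm q m (blockPerm (blockPerm (1 : Equiv.Perm (Fin a))
          (Equiv.swap (0 : Fin 2) 1)) (1 : Equiv.Perm (Fin b))))) = 0 := by
  set s : Equiv.Perm (Fin 2) := Equiv.swap 0 1 with hs
  set σ := blockPerm (blockPerm (1 : Equiv.Perm (Fin a)) s) (1 : Equiv.Perm (Fin b)) with hσ
  ext f g'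
  obtain ⟨g, rfl⟩ : ∃ g, g' = g ∘ σ := ⟨g' ∘ ⇑σ⁻¹, by ext; simp⟩
  obtain ⟨f, v, rfl⟩ := exists_append f
  obtain ⟨u, x, rfl⟩ := exists_append f
  obtain ⟨g, v', rfl⟩ := exists_append g
  obtain ⟨u', y, rfl⟩ := exists_append g
  have h2 := congrFun (congrFun hM.one_sub_mul_one_add x) (y ∘ s)
  rw [one_sub_mul_one_add_apply] at h2
  have hp : ∀ z : Fin 2 → Fin N, ∑ i, pa m ((z ∘ s) i) = ∑ i, pa m (z i) := fun z =>
    Equiv.sum_comp s fun i => pa m (z i)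
  rw [one_sub_mul_one_add_apply]
  simp only [hσ, append_comp_blockPerm, Equiv.Perm.coe_one, Function.comp_id, permWeight_blockPerm,
    permWeight_one, one_mul, mul_one, MProd_append, sum_pa_append, hp]
  have key : ∀ (c d e₁ e₂ : ℂ) (L R X₁ X₂ X₃ X₄ : B),
      X₁ + e₁ • X₂ - e₂ • (X₃ + e₁ • X₄) = 0 →
      c • (d • (L * X₁) * R) + e₁ • c • (d • (L * X₂) * R) -
        e₂ • (c • (d • (L * X₃) * R) + e₁ • c • (d • (L * X₄) * R)) = 0 := by
    intro c d e₁ e₂ L R X₁ X₂ X₃ X₄ h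
    calc _ = c • (d • (L * (X₁ + e₁ • X₂ - e₂ • (X₃ + e₁ • X₄))) * R) := by
          simp only [mul_add, mul_sub, add_mul, sub_mul, mul_smul_comm, smul_mul_assoc]
          module
      _ = 0 := by rw [h]; simp
  exact key _ _ _ _ _ _ _ _ _ _ h2

/-- The permutations of `Fin k` which fix every position `≥ r`. -/
noncomputable def fixingPerms (k r : ℕ) : Finset (Equiv.Perm (Fin k)) :=
  Finset.univ.filter fun σ => ∀ t : Fin k, r ≤ t → σ t = t

lemma mem_fixingPerms {k r : ℕ} {σ : Equiv.Perm (Fin k)} :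
    σ ∈ fixingPerms k r ↔ ∀ t : Fin k, r ≤ t → σ t = t := by
  simp [fixingPerms]

lemma mul_mem_fixingPerms {k r : ℕ} {σ τ : Equiv.Perm (Fin k)} (hσ : σ ∈ fixingPerms k r)
    (hτ : τ ∈ fixingPerms k r) : σ * τ ∈ fixingPerms k r := by
  rw [mem_fixingPerms] at *
  intro t ht
  rw [Equiv.Perm.mul_apply, hτ t ht, hσ t ht]

lemma inv_mem_fixingPerms {k r : ℕ} {σ : Equiv.Perm (Fin k)} (hσ : σ ∈ fixingPerms k r) :
    σ⁻¹ ∈ fixingPerms k r := by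
  rw [mem_fixingPerms] at *
  intro t ht
  rw [Equiv.Perm.inv_eq_iff_eq, hσ t ht]

lemma swap_mem_fixingPerms {k r : ℕ} {i j : Fin k} (hi : (i : ℕ) < r) (hj : (j : ℕ) < r) :
    Equiv.swap i j ∈ fixingPerms k r := by
  rw [mem_fixingPerms]
  intro t ht
  exact Equiv.swap_apply_of_ne_of_ne (by rintro rfl; omega) (by rintro rfl; omega)

/-- The sign of a permutation as a complex number. -/
noncomputable def csgn {k : ℕ} (σ : Equiv.Perm (Fin k)) : ℂ := ((Equiv.Perm.sign σ : ℤ) : ℂ)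

lemma csgn_mul {k : ℕ} (σ τ : Equiv.Perm (Fin k)) : csgn (σ * τ) = csgn σ * csgn τ := by
  simp [csgn]

lemma csgn_mul_self {k : ℕ} (σ : Equiv.Perm (Fin k)) : csgn σ * csgn σ = 1 := by
  rcases Int.units_eq_one_or (Equiv.Perm.sign σ) with h | h <;> simp [csgn, h]

lemma csgn_swap {k : ℕ} {i j : Fin k} (h : i ≠ j) : csgn (Equiv.swap i j) = -1 := by
  simp [csgn, Equiv.Perm.sign_swap h]

/-- The unnormalized `q`-antisymmetrizer over the first `r` tensor positions. -/
noncomputable def antisym (q : ℂ) (m N k r : ℕ) : Matrix (Fin k → Fin N) (Fin k → Fin N) ℂ :=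
  ∑ σ ∈ fixingPerms k r, csgn σ • Pperm q m σ

lemma antisym_mul_Pperm {q : ℂ} (hq : q ≠ 0) (m N : ℕ) {k r : ℕ} {θ : Equiv.Perm (Fin k)}
    (hθ : θ ∈ fixingPerms k r) :
    antisym q m N k r * Pperm q m θ = csgn θ • antisym q m N k r := by
  simp only [antisym, Finset.sum_mul, Finset.smul_sum, smul_mul_assoc, Pperm_mul hq, smul_smul]
  refine Finset.sum_bij' (fun σ _ => σ * θ) (fun σ _ => σ * θ⁻¹)
    (fun σ h => mul_mem_fixingPerms h hθ)
    (fun σ h => mul_mem_fixingPerms h (inv_mem_fixingPerms hθ)) (by simp) (by simp) ?_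
  intro σ _
  rw [csgn_mul, mul_left_comm, csgn_mul_self, mul_one]

lemma Pperm_mul_antisym {q : ℂ} (hq : q ≠ 0) (m N : ℕ) {k r : ℕ} {θ : Equiv.Perm (Fin k)}
    (hθ : θ ∈ fixingPerms k r) :
    Pperm q m θ * antisym q m N k r = csgn θ • antisym q m N k r := by
  simp only [antisym, Finset.mul_sum, Finset.smul_sum, mul_smul_comm, Pperm_mul hq, smul_smul]
  refine Finset.sum_bij' (fun σ _ => θ * σ) (fun σ _ => θ⁻¹ * σ)
    (fun σ h => mul_mem_fixingPerms hθ h)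
    (fun σ h => mul_mem_fixingPerms (inv_mem_fixingPerms hθ) h) (by simp) (by simp) ?_
  intro σ _
  rw [csgn_mul, ← mul_assoc, csgn_mul_self, one_mul]

lemma antisym_mul_MProd_mul_adjacent {q : ℂ} (hq : q ≠ 0) {m N : ℕ}
    {M : Matrix (Fin N) (Fin N) B} (hM : IsManin2 q m M) {k r : ℕ} {i j : Fin k}
    (hij : (j : ℕ) = i + 1) (hj : (j : ℕ) < r) :
    cmap (antisym q m N k r) * MProd m M k * cmap (Pperm q m (Equiv.swap i j)) =
      -(cmap (antisym q m N k r) * MProd m M k) := by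
  have hQ := antisym_mul_Pperm hq m N (swap_mem_fixingPerms (i := i) (j := j) (by omega) hj)
  rw [csgn_swap (by rintro rfl; omega)] at hQ
  have hQ' : (cmap (antisym q m N k r) * (1 - cmap (Pperm q m (Equiv.swap i j))) :
      Matrix (Fin k → Fin N) (Fin k → Fin N) B) = (2 : ℂ) • cmap (antisym q m N k r) := by
    rw [mul_sub, mul_one, ← cmap_mul, hQ, cmap_smul, two_smul, neg_one_smul, sub_neg_eq_add]
  have h0 : (1 - cmap (Pperm q m (Equiv.swap i j))) * MProd m M k *
      (1 + cmap (Pperm q m (Equiv.swap i j))) = 0 := by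
    obtain ⟨a, b, hk, ha⟩ : ∃ a b, k = a + 2 + b ∧ (i : ℕ) = a :=
      ⟨i, k - (i + 2), by have := j.2; omega, rfl⟩
    subst hk
    have hi : i = Fin.castAdd b (Fin.natAdd a (0 : Fin 2)) := by ext; simp [ha]
    have hj' : j = Fin.castAdd b (Fin.natAdd a (1 : Fin 2)) := by ext; simp [hij, ha]
    have hs : Equiv.swap i j = blockPerm (blockPerm (1 : Equiv.Perm (Fin a))
        (Equiv.swap (0 : Fin 2) 1)) (1 : Equiv.Perm (Fin b)) := by
      have hne : ∀ t : Fin (a + 2 + b), (t : ℕ) ≠ a → (t : ℕ) ≠ a + 1 →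
          Equiv.swap i j t = t := fun t h1 h2 =>
        Equiv.swap_apply_of_ne_of_ne (by rintro rfl; omega) (by rintro rfl; omega)
      refine Equiv.ext fun t => ?_
      induction t using Fin.addCases with
      | left t =>
        induction t using Fin.addCases with
        | left t =>
          have := t.2
          rw [hne] <;> simp <;> omega
        | right t =>
          rw [hi, hj']
          fin_cases t <;> simp
      | right t => rw [hne] <;> simp <;> omega
    rw [hs]
    exact one_sub_blockPerm_mul_MProd hM a b
  have h2 : (2 : ℂ) • (cmap (antisym q m N k r) * MProd m M k *
      (1 + cmap (Pperm q m (Equiv.swap i j)))) = 0 := by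
    rw [← smul_mul_assoc, ← smul_mul_assoc, ← hQ', mul_assoc _ _ (MProd m M k), mul_assoc, h0,
      mul_zero]
  have h3 := (smul_eq_zero_iff_right (two_ne_zero : (2 : ℂ) ≠ 0)).1 h2
  rw [mul_add, mul_one] at h3
  exact eq_neg_of_add_eq_zero_right h3

lemma antisym_mul_MProd_mul_swap {q : ℂ} (hq : q ≠ 0) {m N : ℕ}
    {M : Matrix (Fin N) (Fin N) B} (hM : IsManin2 q m M) {k r : ℕ} {i j : Fin k}
    (hij : i < j) (hj : (j : ℕ) < r) :
    cmap (antisym q m N k r) * MProd m M k * cmap (Pperm q m (Equiv.swap i j)) =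
      -(cmap (antisym q m N k r) * MProd m M k) := by
  obtain ⟨d, hd⟩ : ∃ d : ℕ, (j : ℕ) = i + 1 + d := ⟨j - (i + 1), by have := Fin.lt_def.1 hij; omega⟩
  induction d generalizing i with
  | zero => exact antisym_mul_MProd_mul_adjacent hq hM (by omega) hj
  | succ d ih =>
    have hj2 := j.2
    set l : Fin k := ⟨i + 1, by omega⟩ with hl
    have h1 := antisym_mul_MProd_mul_adjacent (r := r) hq hM (i := i) (j := l) rfl
      (by simp [hl]; omega)
    have h2 := ih (i := l) (by rw [Fin.lt_def]; simp [hl]; omega) (by simp [hl]; omega)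
    have hs : Equiv.swap i j = Equiv.swap i l * Equiv.swap l j * Equiv.swap i l := by
      rw [Equiv.swap_comm i l, Equiv.swap_comm l j, Equiv.swap_mul_swap_mul_swap]
      · intro h; have := congrArg Fin.val h; simp [hl] at this; omega
      · exact hij.ne'
    rw [hs, ← Pperm_mul hq, ← Pperm_mul hq, cmap_mul, cmap_mul, ← mul_assoc, ← mul_assoc, h1,
      neg_mul, h2, neg_neg, h1]

/-- The supertrace of `P^q_ρ A M₁ ⋯ M_k`, with `A` the unnormalized antisymmetrizer over the first
`r` tensor positions. -/
noncomputable def antisymStr (q : ℂ) (m : ℕ) {N : ℕ} (M : Matrix (Fin N) (Fin N) B) {k : ℕ}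
    (r : ℕ) (ρ : Equiv.Perm (Fin k)) : B :=
  strAll m (cmap (Pperm q m ρ) * cmap (antisym q m N k r) * MProd m M k)

lemma antisymStr_eq_sum {q : ℂ} (hq : q ≠ 0) (m : ℕ) {N : ℕ} (M : Matrix (Fin N) (Fin N) B)
    {k : ℕ} (r : ℕ) (ρ : Equiv.Perm (Fin k)) :
    antisymStr q m M r ρ = ∑ τ ∈ fixingPerms k r,
      csgn τ • strAll m (cmap (Pperm q m (ρ * τ)) * MProd m M k) := by
  simp only [antisymStr, antisym, ← cmap_mul, Finset.mul_sum, mul_smul_comm, Pperm_mul hq,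
    cmap_sum, cmap_smul, Finset.sum_mul, smul_mul_assoc, strAll_sum, strAll_smul]

lemma antisymStr_mul {q : ℂ} (hq : q ≠ 0) (m : ℕ) {N : ℕ} (M : Matrix (Fin N) (Fin N) B)
    {k r : ℕ} (ρ : Equiv.Perm (Fin k)) {θ : Equiv.Perm (Fin k)} (hθ : θ ∈ fixingPerms k r) :
    antisymStr q m M r (ρ * θ) = csgn θ • antisymStr q m M r ρ := by
  rw [antisymStr, ← Pperm_mul hq, ← cmap_mul, mul_assoc, Pperm_mul_antisym hq m N hθ,
    mul_smul_comm, cmap_smul, cmap_mul, smul_mul_assoc, strAll_smul]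
  rfl

lemma antisymStr_swap_mul {q : ℂ} (hq : q ≠ 0) {m N : ℕ} {M : Matrix (Fin N) (Fin N) B}
    (hM : IsManin2 q m M) {k r : ℕ} (ρ : Equiv.Perm (Fin k)) {i j : Fin k} (hij : i < j)
    (hj : (j : ℕ) < r) :
    antisymStr q m M r (Equiv.swap i j * ρ) = -antisymStr q m M r ρ := by
  rw [antisymStr, ← Pperm_mul hq, cmap_mul, mul_assoc, mul_assoc, strAll_Pperm_mul_comm, mul_assoc,
    antisym_mul_MProd_mul_swap hq hM hij hj, ← neg_one_smul ℂ, mul_smul_comm, strAll_smul,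
    neg_one_smul, ← mul_assoc]
  rfl

lemma fixingPerms_succ_sum {α : Type*} [AddCommMonoid α] {k : ℕ} (l : Fin k)
    (F : Equiv.Perm (Fin k) → α) :
    ∑ σ ∈ fixingPerms k (l + 1), F σ =
      ∑ i ∈ Finset.Iic l, ∑ τ ∈ fixingPerms k l, F (Equiv.swap i l * τ) := by
  rw [← Finset.sum_product']
  refine Finset.sum_bij' (fun σ _ => (σ l, Equiv.swap (σ l) l * σ))
    (fun p _ => Equiv.swap p.1 l * p.2) ?_ ?_ ?_ ?_ ?_
  · intro σ hσ
    have hσ' := mem_fixingPerms.1 hσ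
    have hl : σ l ≤ l := by
      by_contra! h
      have := hσ' (σ l) (Fin.lt_def.1 h)
      rw [σ.injective this] at h
      exact lt_irrefl _ h
    simp only [Finset.mem_product, Finset.mem_Iic, hl, true_and, mem_fixingPerms]
    intro t ht
    rcases eq_or_lt_of_le ht with h | h
    · obtain rfl : l = t := Fin.ext h
      simp
    · rw [Equiv.Perm.mul_apply, hσ' t h, Equiv.swap_apply_of_ne_of_ne]
      · intro e; rw [Fin.le_def] at hl; rw [e] at h; omega
      · rintro rfl; omega
  · rintro ⟨i, τ⟩ h
    simp only [Finset.mem_product, Finset.mem_Iic] at h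
    have hi := Fin.le_def.1 h.1
    exact mul_mem_fixingPerms (swap_mem_fixingPerms (by simp; omega) (by simp))
      (mem_fixingPerms.2 fun t ht => mem_fixingPerms.1 h.2 t (by omega))
  · intro σ _
    simp [← mul_assoc]
  · rintro ⟨i, τ⟩ h
    simp only [Finset.mem_product, Finset.mem_Iic] at h
    have := mem_fixingPerms.1 h.2 l le_rfl
    simp [this, ← mul_assoc]
  · intro σ _
    simp [← mul_assoc]

lemma antisymStr_succ {q : ℂ} (hq : q ≠ 0) (m : ℕ) {N : ℕ} (M : Matrix (Fin N) (Fin N) B)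
    {k : ℕ} (l : Fin k) (ρ : Equiv.Perm (Fin k)) :
    antisymStr q m M (l + 1) ρ = antisymStr q m M l ρ -
      ∑ i ∈ Finset.Iio l, antisymStr q m M l (ρ * Equiv.swap i l) := by
  rw [antisymStr_eq_sum hq, fixingPerms_succ_sum, ← Finset.Iio_insert,
    Finset.sum_insert (by simp), Equiv.swap_self, ← Equiv.Perm.one_def, sub_eq_add_neg,
    ← Finset.sum_neg_distrib]
  congr 1
  · simp [antisymStr_eq_sum hq]
  · refine Finset.sum_congr rfl fun i hi => ?_
    have hne : i ≠ l := (Finset.mem_Iio.1 hi).ne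
    simp only [antisymStr_eq_sum hq, csgn_mul, csgn_swap hne, neg_one_mul, neg_smul,
      Finset.sum_neg_distrib, mul_assoc]

lemma antisymStr_mul_swap {q : ℂ} (hq : q ≠ 0) {m N : ℕ} {M : Matrix (Fin N) (Fin N) B}
    (hM : IsManin2 q m M) {k r : ℕ} {ρ : Equiv.Perm (Fin k)} {i j l : Fin k} (hij : i < j)
    (hj : (j : ℕ) < r) (hl : r ≤ l) (hρ : ρ * Equiv.swap i j = Equiv.swap i j * ρ) :
    antisymStr q m M r (ρ * Equiv.swap i l) = antisymStr q m M r (ρ * Equiv.swap j l) := by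
  have hij' := Fin.lt_def.1 hij
  have hs : Equiv.swap i l = Equiv.swap i j * Equiv.swap j l * Equiv.swap i j := by
    rw [Equiv.swap_comm i j, Equiv.swap_comm j l, Equiv.swap_mul_swap_mul_swap]
    · rintro rfl; omega
    · rintro rfl; omega
  rw [hs, ← mul_assoc, ← mul_assoc, antisymStr_mul hq m M _
    (swap_mem_fixingPerms (by omega) hj), csgn_swap hij.ne, hρ, mul_assoc,
    antisymStr_swap_mul hq hM _ hij hj, neg_one_smul, neg_neg]

/-- The cyclic permutation of the positions `≥ r` of `Fin (K + 1)` which sends `r` to the last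
position and lowers all larger positions by one. -/
def tailCycle (K r : ℕ) (hr : r ≤ K) : Equiv.Perm (Fin (K + 1)) where
  toFun x := ⟨if (x : ℕ) < r then x else if (x : ℕ) = r then K else x - 1, by
    have := x.2; split_ifs <;> omega⟩
  invFun x := ⟨if (x : ℕ) < r then x else if (x : ℕ) = K then r else x + 1, by
    have := x.2; split_ifs <;> omega⟩
  left_inv x := by
    have := x.2
    ext; dsimp only; split_ifs <;> omega
  right_inv x := by
    have := x.2
    ext; dsimp only; split_ifs <;> omega

lemma tailCycle_self (K : ℕ) : tailCycle K K le_rfl = 1 := by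
  ext x
  have := x.2
  simp only [tailCycle, Equiv.coe_fn_mk, Equiv.Perm.one_apply]
  split_ifs <;> omega

lemma tailCycle_succ_mul_swap (K r : ℕ) (hr : r + 1 ≤ K) :
    tailCycle K (r + 1) hr * Equiv.swap ⟨r, by omega⟩ ⟨r + 1, by omega⟩ =
      tailCycle K r (by omega) := by
  ext x
  have := x.2
  simp only [tailCycle, Equiv.coe_fn_mk, Equiv.Perm.mul_apply, Equiv.swap_apply_def, Fin.ext_iff]
  split_ifs <;> simp_all <;> omega

lemma tailCycle_mul_swap (K r : ℕ) (hr : r ≤ K) {i j : Fin (K + 1)} (hi : (i : ℕ) < r)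
    (hj : (j : ℕ) < r) :
    tailCycle K r hr * Equiv.swap i j = Equiv.swap i j * tailCycle K r hr := by
  have h : ∀ t : Fin (K + 1), (t : ℕ) < r → tailCycle K r hr t = t := fun t ht => by
    ext; simp [tailCycle, ht]
  rw [Equiv.mul_swap_eq_swap_mul, h i hi, h j hj]

lemma antisymStr_tailCycle_succ {q : ℂ} (hq : q ≠ 0) {m N : ℕ} {M : Matrix (Fin N) (Fin N) B}
    (hM : IsManin2 q m M) (K r : ℕ) (hr : r + 1 ≤ K) :
    antisymStr q m M (r + 2) (tailCycle K (r + 1) hr) =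
      antisymStr q m M (r + 1) (tailCycle K (r + 1) hr) -
        ((r + 1 : ℕ) : ℂ) • antisymStr q m M (r + 1) (tailCycle K r (by omega)) := by
  have h := antisymStr_succ hq m M (⟨r + 1, by omega⟩ : Fin (K + 1)) (tailCycle K (r + 1) hr)
  rw [h, ← tailCycle_succ_mul_swap K r hr]
  congr 1
  rw [Finset.sum_congr rfl (g := fun _ => antisymStr q m M (r + 1)
    (tailCycle K (r + 1) hr * Equiv.swap ⟨r, by omega⟩ ⟨r + 1, by omega⟩)), Finset.sum_const]
  · rw [Fin.card_Iio, Nat.cast_smul_eq_nsmul]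
  · intro i hi
    have hi' : (i : ℕ) < r + 1 := Fin.lt_def.1 (Finset.mem_Iio.1 hi)
    rcases Nat.lt_succ_iff_lt_or_eq.1 hi' with h | h
    · exact antisymStr_mul_swap hq hM (Fin.lt_def.2 h) (by simp) le_rfl
        (tailCycle_mul_swap K (r + 1) hr hi' (by simp))
    · rw [show i = ⟨r, by omega⟩ from Fin.ext h]

lemma sum_append {α : Type*} [Fintype α] {β : Type*} [AddCommMonoid β] {a b : ℕ}
    (F : (Fin (a + b) → α) → β) :
    ∑ f, F f = ∑ u : Fin a → α, ∑ v : Fin b → α, F (Fin.append u v) := by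
  rw [← Fintype.sum_prod_type', ← Equiv.sum_comp (Fin.appendEquiv a b)]
  rfl

lemma strAll_blockPerm (q : ℂ) (m : ℕ) {N : ℕ} (M : Matrix (Fin N) (Fin N) B) {a b : ℕ}
    (σ : Equiv.Perm (Fin a)) (τ : Equiv.Perm (Fin b)) :
    strAll m (cmap (Pperm q m (blockPerm σ τ)) * MProd m M (a + b)) =
      strAll m (cmap (Pperm q m σ) * MProd m M a) *
        strAll m (cmap (Pperm q m τ) * MProd m M b) := by
  simp only [strAll, sum_append, Finset.sum_mul_sum, cmap_Pperm_mul_apply, append_comp_blockPerm,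
    permWeight_blockPerm, MProd_append, sum_pa_append]
  refine Finset.sum_congr rfl fun u _ => Finset.sum_congr rfl fun v _ => ?_
  have h : ∑ i, pa m ((v ∘ τ) i) = ∑ i, pa m (v i) := Equiv.sum_comp τ fun i => pa m (v i)
  rw [h, ← two_mul, mul_assoc, pow_mul _ 2, neg_one_sq, one_pow, one_smul, pow_add]
  simp only [smul_mul_assoc, mul_smul_comm, smul_smul]
  congr 1
  ring

lemma blockPerm_mul {a b : ℕ} (σ σ' : Equiv.Perm (Fin a)) (τ τ' : Equiv.Perm (Fin b)) :
    blockPerm σ τ * blockPerm σ' τ' = blockPerm (σ * σ') (τ * τ') := by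
  ext i
  refine Fin.addCases (fun i => ?_) (fun i => ?_) i <;> simp

lemma csgn_blockPerm_one {a : ℕ} (b : ℕ) (σ : Equiv.Perm (Fin a)) :
    csgn (blockPerm σ (1 : Equiv.Perm (Fin b))) = csgn σ := by
  have : Equiv.sumCongr σ (1 : Equiv.Perm (Fin b)) = Equiv.Perm.sumCongr σ 1 := rfl
  rw [csgn, csgn, blockPerm, Equiv.Perm.sign_permCongr, this, Equiv.Perm.sign_sumCongr, map_one,
    mul_one]

lemma sum_fixingPerms_eq_sum_blockPerm {α : Type*} [AddCommMonoid α] (a b : ℕ)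
    (F : Equiv.Perm (Fin (a + b)) → α) :
    ∑ σ ∈ fixingPerms (a + b) a, F σ = ∑ σ : Equiv.Perm (Fin a), F (blockPerm σ 1) := by
  symm
  refine Finset.sum_bij (fun σ _ => blockPerm σ 1) ?_ ?_ ?_ (fun _ _ => rfl)
  · intro σ _
    rw [mem_fixingPerms]
    intro t
    refine Fin.addCases (fun i h => ?_) (fun i _ => ?_) t
    · have := i.2
      simp at h; omega
    · simp
  · intro σ _ τ _ h
    ext i
    have := congrArg (fun ρ => (ρ (Fin.castAdd b i) : ℕ)) h
    simpa using this
  · intro σ hσ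
    have key : ∀ τ ∈ fixingPerms (a + b) a, ∀ i : Fin a, (τ (Fin.castAdd b i) : ℕ) < a := by
      intro τ hτ i
      by_contra! h
      have := τ.injective (mem_fixingPerms.1 hτ _ h)
      rw [this] at h
      have := i.2
      simp at h; omega
    refine ⟨⟨fun i => ⟨σ (Fin.castAdd b i), key σ hσ i⟩,
      fun i => ⟨σ⁻¹ (Fin.castAdd b i), key _ (inv_mem_fixingPerms hσ) i⟩, fun i => ?_,
      fun i => ?_⟩, Finset.mem_univ _, ?_⟩
    · ext
      simp
    · ext
      simp
    · ext t
      refine Fin.addCases (fun i => ?_) (fun i => ?_) t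
      · simp
      · rw [mem_fixingPerms.1 hσ _ (by simp)]
        simp

lemma tailCycle_eq_blockPerm (r j : ℕ) :
    tailCycle (r + j) r (by omega) =
      blockPerm (a := r) (b := j + 1) 1 (tailCycle j 0 (by omega)) := by
  ext t
  refine Fin.addCases (m := r) (n := j + 1) (fun i => ?_) (fun i => ?_) t
  · have : (i : ℕ) < r := i.2
    rw [blockPerm_castAdd]
    simp [tailCycle]
  · rw [blockPerm_natAdd]
    simp only [tailCycle, Equiv.coe_fn_mk, Fin.val_natAdd]
    split_ifs <;> omega

lemma factorial_smul_strAll_AqS (q : ℂ) (m : ℕ) {N : ℕ} (M : Matrix (Fin N) (Fin N) B) (k : ℕ) :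
    ((k.factorial : ℕ) : ℂ) •
        strAll m (cmap (AqS q m (Finset.univ : Finset (Fin k))) * MProd m M k) =
      ∑ σ : Equiv.Perm (Fin k), csgn σ • strAll m (cmap (Pperm q m σ) * MProd m M k) := by
  have h : (Finset.univ.filter fun σ : Equiv.Perm (Fin k) =>
      ∀ t ∉ (Finset.univ : Finset (Fin k)), σ t = t) = Finset.univ := by simp
  rw [AqS, h, cmap_smul, smul_mul_assoc, strAll_smul, smul_smul, Finset.card_univ, Fintype.card_fin,
    mul_inv_cancel₀ (by exact_mod_cast k.factorial_ne_zero), one_smul]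
  simp only [cmap_sum, cmap_smul, Finset.sum_mul, smul_mul_assoc, strAll_sum, strAll_smul]
  rfl

lemma antisymStr_tailCycle {q : ℂ} (hq : q ≠ 0) (m : ℕ) {N : ℕ} (M : Matrix (Fin N) (Fin N) B)
    (r j : ℕ) :
    antisymStr q m M r (tailCycle (r + j) r (by omega)) =
      ((r.factorial : ℕ) : ℂ) •
        (strAll m (cmap (AqS q m (Finset.univ : Finset (Fin r))) * MProd m M r) *
          strAll m (cmap (Pperm q m (tailCycle j 0 (by omega))) * MProd m M (j + 1))) := by
  rw [antisymStr_eq_sum hq, ← smul_mul_assoc, factorial_smul_strAll_AqS, Finset.sum_mul,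
    tailCycle_eq_blockPerm]
  refine (sum_fixingPerms_eq_sum_blockPerm r (j + 1) _).trans (Finset.sum_congr rfl fun σ _ => ?_)
  rw [csgn_blockPerm_one, blockPerm_mul, one_mul, mul_one, smul_mul_assoc]
  exact congrArg _ (strAll_blockPerm q m M σ _)

lemma neg_one_pow_congr {a b : ℕ} (h : (a : ZMod 2) = b) : (-1 : ℂ) ^ a = (-1) ^ b := by
  have h' : a % 2 = b % 2 := (ZMod.natCast_eq_natCast_iff' a b 2).1 h
  rw [← Nat.div_add_mod a 2, ← Nat.div_add_mod b 2, h', pow_add, pow_add, pow_mul, pow_mul]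
  simp

/-- The matrix of signed entries `(-1)^{\bar i\bar j+\bar j} X_{ij}`. -/
noncomputable def signed (m : ℕ) {N : ℕ} (X : Matrix (Fin N) (Fin N) B) (i j : Fin N) : B :=
  ((-1 : ℂ) ^ (pa m i * pa m j + pa m j)) • X i j

lemma Mslot_mul_Mslot_apply (m : ℕ) {N : ℕ} (X Y : Matrix (Fin N) (Fin N) B) (i j a : Fin N) :
    (Mslot m X (0 : Fin 2) * Mslot m Y (1 : Fin 2)) ![i, a] ![a, j] =
      (-1 : ℂ) ^ ((pa m a + pa m j) * pa m a) • (signed m X i a * signed m Y a j) := by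
  rw [Matrix.mul_apply, Finset.sum_eq_single ![a, a]]
  · simp [Mslot_apply, Fin.forall_fin_two, slotSign, signed, Finset.sum_filter, smul_smul, pow_add,
      mul_comm]
    congr 1
    ring
  · intro h _ hne
    rw [Mslot_apply, Mslot_apply]
    split_ifs with h1 h2
    · refine absurd (funext fun b => ?_) hne
      have e1 := h1 1 (by simp)
      have e2 := h2 0 (by simp)
      fin_cases b
      · simpa using e2
      · simpa using e1.symm
    all_goals simp
  · simp

lemma signed_starMul (q : ℂ) (m : ℕ) {N : ℕ} (X Y : Matrix (Fin N) (Fin N) B) (i j : Fin N) :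
    signed m (starMul q m X Y) i j =
      ∑ a, q ^ eps i a • (signed m X i a * signed m Y a j) := by
  rw [signed, starMul, Matrix.of_apply, smul_smul, Finset.smul_sum]
  refine Finset.sum_congr rfl fun a _ => ?_
  have hc : (![a, i] ∘ ⇑(Equiv.swap (0 : Fin 2) 1)) = ![i, a] := by
    ext b; fin_cases b <;> simp
  have hw : permWeight q m (Equiv.swap (0 : Fin 2) 1) ![i, a] =
      q ^ eps i a * (-1) ^ (pa m i * pa m a) := by
    simp [permWeight, Fin.prod_univ_two, swapCoeff]
  rw [mul_assoc, cmap_Pperm_mul_apply, hc, hw, Mslot_mul_Mslot_apply]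
  simp only [smul_smul]
  congr 1
  have h2 : (2 : ZMod 2) = 0 := rfl
  have hsq : ((pa m a : ℕ) : ZMod 2) ^ 2 = pa m a := by
    unfold pa; split_ifs <;> simp
  have hs : (-1 : ℂ) ^ (pa m i * pa m j + pa m j + (pa m i * pa m j + pa m j) +
      pa m a * (1 + pa m i + pa m j) + pa m i * pa m a + (pa m a + pa m j) * pa m a) = 1 := by
    rw [neg_one_pow_congr (b := 0), pow_zero]
    push_cast
    linear_combination h2 * ((pa m i : ZMod 2) * pa m j + pa m j + pa m a + pa m i * pa m a +
      pa m a * pa m j) + hsq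
  simp only [pow_add _ (_ + _)] at hs ⊢
  linear_combination q ^ eps i a * hs

lemma sum_snoc {α : Type*} [Fintype α] {β : Type*} [AddCommMonoid β] {k : ℕ}
    (F : (Fin (k + 1) → α) → β) :
    ∑ f, F f = ∑ f : Fin k → α, ∑ x : α, F (Fin.snoc (α := fun _ => α) f x) := by
  rw [Finset.sum_comm, ← Fintype.sum_prod_type',
    ← Equiv.sum_comp (Fin.snocEquiv (fun _ : Fin (k + 1) => α))]
  rfl

lemma signed_Mpow (q : ℂ) (m : ℕ) {N : ℕ} (M : Matrix (Fin N) (Fin N) B) (k : ℕ) (i j : Fin N) :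
    signed m (Mpow q m M (k + 1)) i j = ∑ f : Fin k → Fin N,
      ((∏ a, q ^ eps i (f a)) * (-1 : ℂ) ^ ((∑ a, pa m (f a)) * (1 + pa m j))) •
        MProd m M (k + 1) (Fin.cons (α := fun _ => Fin N) i f)
          (Fin.snoc (α := fun _ => Fin N) f j) := by
  induction k generalizing j with
  | zero =>
    simp [MProd_apply, slotSign, signed, Mpow, Fin.snoc]
  | succ k ih =>
    have hM : signed m (Mpow q m M (k + 1 + 1)) i j =
      ∑ a, q ^ eps i a • (signed m (Mpow q m M (k + 1)) i a * signed m M a j) :=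
      signed_starMul q m (Mpow q m M (k + 1)) M i j
    rw [hM, sum_snoc, Finset.sum_comm]
    refine Finset.sum_congr rfl fun x _ => ?_
    rw [ih, Finset.sum_mul, Finset.smul_sum]
    refine Finset.sum_congr rfl fun f _ => ?_
    have h1 : MProd m M (k + 1 + 1)
        (Fin.cons (α := fun _ => Fin N) i (Fin.snoc (α := fun _ => Fin N) f x))
        (Fin.snoc (α := fun _ => Fin N) (Fin.snoc (α := fun _ => Fin N) f x) j) =
        ((-1 : ℂ) ^ ((pa m x + pa m j) * (∑ a, pa m (f a) + pa m x))) •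
          (MProd m M (k + 1) (Fin.cons (α := fun _ => Fin N) i f)
            (Fin.snoc (α := fun _ => Fin N) f x) * signed m M x j) := by
      have := MProd_append m M (Fin.cons (α := fun _ => Fin N) i f)
        (Fin.snoc (α := fun _ => Fin N) f x) (fun _ : Fin 1 => x) (fun _ : Fin 1 => j)
      rw [Fin.append_right_eq_snoc, Fin.append_right_eq_snoc, ← Fin.cons_snoc_eq_snoc_cons] at this
      rw [this]
      simp [Fin.sum_univ_castSucc, MProd_apply, slotSign, signed]
    rw [h1]
    simp only [smul_mul_assoc, smul_smul, Fin.prod_univ_castSucc, Fin.sum_univ_castSucc,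
      Fin.snoc_castSucc, Fin.snoc_last]
    congr 1
    have h2 : (2 : ZMod 2) = 0 := rfl
    have hsq : ((pa m x : ℕ) : ZMod 2) ^ 2 = pa m x := by
      unfold pa; split_ifs <;> simp
    have hs : (-1 : ℂ) ^ ((∑ a, pa m (f a) + pa m x) * (1 + pa m j)) *
        (-1) ^ ((pa m x + pa m j) * (∑ a, pa m (f a) + pa m x)) =
        (-1) ^ ((∑ a, pa m (f a)) * (1 + pa m x)) := by
      rw [← pow_add]
      apply neg_one_pow_congr
      push_cast
      linear_combination h2 * ((∑ a, (pa m (f a) : ZMod 2)) * pa m j + pa m x * pa m j +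
        pa m x) + hsq
    rw [← hs]
    ring

lemma strAll_tailCycle (q : ℂ) (m : ℕ) {N : ℕ} (M : Matrix (Fin N) (Fin N) B) (k : ℕ) :
    strAll m (cmap (Pperm q m (tailCycle k 0 (by omega))) * MProd m M (k + 1)) =
      coefT q m M k := by
  rw [strAll, sum_snoc, Finset.sum_comm, coefT, strM]
  refine Finset.sum_congr rfl fun i _ => ?_
  have hd : Mpow q m M (k + 1) i i = signed m (Mpow q m M (k + 1)) i i := by
    have : (-1 : ℂ) ^ (pa m i * pa m i + pa m i) = 1 := by
      unfold pa; split_ifs <;> simp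
    rw [signed, this, one_smul]
  rw [hd, signed_Mpow, Finset.smul_sum]
  refine Finset.sum_congr rfl fun f _ => ?_
  have h0 : tailCycle k 0 (by omega) 0 = Fin.last k := by
    ext; simp [tailCycle]
  have hs : ∀ a : Fin k, tailCycle k 0 (by omega) a.succ = a.castSucc := fun a => by
    ext; simp [tailCycle]
  have hc : Fin.snoc (α := fun _ => Fin N) f i ∘ tailCycle k 0 (by omega) =
      Fin.cons (α := fun _ => Fin N) i f := by
    ext a
    refine Fin.cases ?_ (fun a => ?_) a
    · simp [h0]
    · simp [hs]
  have hw : permWeight q m (tailCycle k 0 (by omega)) (Fin.cons (α := fun _ => Fin N) i f) =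
      ∏ a, swapCoeff q m i (f a) := by
    have hlt : ∀ a b : Fin k, ¬ (a < b ∧ b < a) := fun a b h => lt_asymm h.1 h.2
    simp [permWeight, Fin.prod_univ_succ, h0, hs, hlt, Fin.castSucc_lt_last]
  rw [cmap_Pperm_mul_apply, hc, hw, smul_smul, smul_smul]
  congr 1
  simp only [swapCoeff, Finset.prod_mul_distrib, Finset.prod_pow_eq_pow_sum, ← Finset.mul_sum,
    Fin.sum_univ_castSucc, Fin.snoc_castSucc, Fin.snoc_last]
  ring

lemma antisymStr_succ_tailCycle {q : ℂ} (hq : q ≠ 0) {m N : ℕ} {M : Matrix (Fin N) (Fin N) B}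
    (hM : IsManin2 q m M) (K r : ℕ) (hr : r ≤ K) :
    antisymStr q m M (r + 1) (tailCycle K r hr) =
      ((r.factorial : ℕ) : ℂ) • ∑ s ∈ Finset.range (r + 1), (-1 : ℂ) ^ (r - s) •
        (strAll m (cmap (AqS q m (Finset.univ : Finset (Fin s))) * MProd m M s) *
          coefT q m M (K - s)) := by
  have hfac : ∀ r (hr : r ≤ K), antisymStr q m M r (tailCycle K r hr) =
      ((r.factorial : ℕ) : ℂ) •
        (strAll m (cmap (AqS q m (Finset.univ : Finset (Fin r))) * MProd m M r) *
          coefT q m M (K - r)) := by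
    intro r hr
    obtain ⟨j, rfl⟩ := Nat.exists_eq_add_of_le hr
    rw [← strAll_tailCycle, Nat.add_sub_cancel_left]
    exact antisymStr_tailCycle hq m M r j
  induction r with
  | zero =>
    have h := antisymStr_succ hq m M (0 : Fin (K + 1)) (tailCycle K 0 hr)
    rw [show Finset.Iio (0 : Fin (K + 1)) = ∅ from by ext; simp, Finset.sum_empty, sub_zero] at h
    have h' := h.trans (hfac 0 hr)
    simpa using h'
  | succ r ih =>
    rw [antisymStr_tailCycle_succ hq hM K r hr, hfac, ih (by omega),
      Finset.sum_range_succ _ (r + 1), smul_add, Nat.sub_self, pow_zero, one_smul, smul_smul, ← Nat.cast_mul, ← Nat.factorial_succ,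
      sub_eq_add_neg, add_comm, ← smul_neg, ← Finset.sum_neg_distrib]
    congr 2
    refine Finset.sum_congr rfl fun s hs => ?_
    rw [Nat.succ_sub (Nat.lt_succ_iff.1 (Finset.mem_range.1 hs)), pow_succ, mul_neg_one, neg_smul]

lemma coefA_succ {q : ℂ} (hq : q ≠ 0) {m N : ℕ} {M : Matrix (Fin N) (Fin N) B}
    (hM : IsManin2 q m M) (K : ℕ) :
    ((K + 1 : ℕ) : ℂ) • coefA q m M (K + 1) =
      -∑ s ∈ Finset.range (K + 1), coefA q m M s * coefT q m M (K - s) := by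
  have h := antisymStr_succ_tailCycle hq hM K K le_rfl
  have hall : fixingPerms (K + 1) (K + 1) = Finset.univ := by
    ext σ
    simp only [mem_fixingPerms, Finset.mem_univ, iff_true]
    intro t ht
    exact absurd t.2 (by omega)
  rw [tailCycle_self, antisymStr_eq_sum hq, hall] at h
  simp only [one_mul] at h
  rw [← factorial_smul_strAll_AqS, Nat.factorial_succ, mul_comm, Nat.cast_mul, mul_smul] at h
  have h' := smul_right_injective B (show ((K.factorial : ℕ) : ℂ) ≠ 0 from
    by exact_mod_cast K.factorial_ne_zero) h
  rw [coefA, smul_comm, h', Finset.smul_sum, ← Finset.sum_neg_distrib]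
  refine Finset.sum_congr rfl fun s hs => ?_
  have hs' : s ≤ K := Nat.lt_succ_iff.1 (Finset.mem_range.1 hs)
  rw [coefA, smul_mul_assoc, smul_smul, ← neg_smul]
  congr 1
  obtain ⟨d, rfl⟩ := Nat.exists_eq_add_of_le hs'
  rw [Nat.add_sub_cancel_left, pow_succ, pow_add]
  have : (-1 : ℂ) ^ d * (-1) ^ d = 1 := by rw [← mul_pow]; simp
  linear_combination -(-1 : ℂ) ^ s * this

/-- Newton's identity, antisymmetric form: `∂ₜA(t) = -A(t)T(t)`. -/
theorem stmt12 (m n : ℕ) (q : ℂ) (hq : q ≠ 0) (A : Type*) [Ring A] [Algebra ℂ A]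
    (M : Matrix (Fin (m + n)) (Fin (m + n)) A) (hM : IsManin2 q m M) :
    PowerSeries.mk (fun k => ((k + 1 : ℕ) : ℂ) • coefA q m M (k + 1))
      = -(PowerSeries.mk (coefA q m M) * PowerSeries.mk (coefT q m M)) := by
  ext K
  simp only [map_neg, PowerSeries.coeff_mul, PowerSeries.coeff_mk]
  rw [coefA_succ hq hM, Finset.Nat.sum_antidiagonal_eq_sum_range_succ
    (fun a b => coefA q m M a * coefT q m M b)]

end QSM
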